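/- arXiv:2412.04230 — 2 statements merged into one kernel-verified Lean document; each statement's English description precedes it below -/
import Mathlib

section
/- Let W : ℝ × ℝⁿ → ℝ and F : ℝ × ℝⁿ → ℝⁿ be smooth (C^∞) functions satisfying the classical master homotopy equation ∂W/∂t(t,x) + ⟨∇_x W(t,x), F(t,x)⟩ = 0 for all (t,x). Let x₀ : ℝ → ℝⁿ be a differentiable curve of critical points, i.e. ∇_x W(t, x₀(t)) = 0 for all t, and assume the Hessian matrix A(t) = (∂_i∂_j W)(t, x₀(t)) (second derivatives in the x-variables) is invertible for every t. Then the critical point moves along the vector field F: for every t, x₀'(t) = F(t, x₀(t)). -/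
open scoped BigOperators
open Matrix

/-- Gradient of `W` in the `x`-variables: `(∇ₓ W)(t,x) i = ∂W/∂xᵢ (t,x)`. -/
noncomputable def gradx (n : ℕ) (W : ℝ × (Fin n → ℝ) → ℝ) (t : ℝ) (x : Fin n → ℝ) :
    Fin n → ℝ :=
  fun i => fderiv ℝ (fun y => W (t, y)) x (Pi.single i 1)

/-- Hessian of `W` in the `x`-variables: `(∂ᵢ∂ⱼ W)(t,x)`. -/
noncomputable def hessx (n : ℕ) (W : ℝ × (Fin n → ℝ) → ℝ) (t : ℝ) (x : Fin n → ℝ) :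
    Matrix (Fin n) (Fin n) ℝ :=
  Matrix.of fun i j => fderiv ℝ (fun y => gradx n W t y j) x (Pi.single i 1)

/-- Jacobian matrix of `F` in the `x`-variables: `(∂Fᵢ/∂xⱼ)(t,x)`. -/
noncomputable def jacx (n : ℕ) (F : ℝ × (Fin n → ℝ) → (Fin n → ℝ)) (t : ℝ) (x : Fin n → ℝ) :
    Matrix (Fin n) (Fin n) ℝ :=
  Matrix.of fun i j => fderiv ℝ (fun y => F (t, y) i) x (Pi.single j 1)

theorem gradx_eq_fderiv {n : ℕ} {W : ℝ × (Fin n → ℝ) → ℝ} (hW : Differentiable ℝ W)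
    (t : ℝ) (x : Fin n → ℝ) (i : Fin n) :
    gradx n W t x i = fderiv ℝ W (t, x) (0, Pi.single i 1) := by
  have h := (hW (t, x)).hasFDerivAt.comp x (hasFDerivAt_prodMk_right t x)
  change fderiv ℝ (W ∘ fun y => (t, y)) x (Pi.single i 1) = _
  rw [h.fderiv]
  simp

theorem hessx_eq_fderiv_fderiv {n : ℕ} {W : ℝ × (Fin n → ℝ) → ℝ} (hW : Differentiable ℝ W)
    (hW' : Differentiable ℝ (fderiv ℝ W)) (t : ℝ) (x : Fin n → ℝ) (i j : Fin n) :
    hessx n W t x i j =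
      fderiv ℝ (fderiv ℝ W) (t, x) (0, Pi.single i 1) (0, Pi.single j 1) := by
  have h := ((hW' (t, x)).hasFDerivAt.comp x (hasFDerivAt_prodMk_right t x)).clm_apply
    (hasFDerivAt_const ((0 : ℝ), (Pi.single j 1 : Fin n → ℝ)) x)
  have e : (fun y => gradx n W t y j) =
      fun y => (fderiv ℝ W ∘ fun y => (t, y)) y (0, Pi.single j 1) :=
    funext fun y => gradx_eq_fderiv hW t y j
  simp only [hessx, Matrix.of_apply]
  rw [e, h.fderiv]
  simp

theorem deriv_time_eq_fderiv {n : ℕ} {W : ℝ × (Fin n → ℝ) → ℝ} (hW : Differentiable ℝ W)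
    (t : ℝ) (x : Fin n → ℝ) :
    deriv (fun s => W (s, x)) t = fderiv ℝ W (t, x) (1, 0) := by
  have h := (hW (t, x)).hasFDerivAt.comp_hasDerivAt t
    ((hasDerivAt_id t).prodMk (hasDerivAt_const t x))
  exact h.deriv

theorem map_zero_prodMk_eq_sum {n : ℕ} (L : ℝ × (Fin n → ℝ) →L[ℝ] ℝ) (v : Fin n → ℝ) :
    L (0, v) = ∑ i, L (0, Pi.single i 1) * v i := by
  have h := LinearMap.pi_apply_eq_sum_univ
    ((L.comp (ContinuousLinearMap.inr ℝ ℝ (Fin n → ℝ))) : (Fin n → ℝ) →ₗ[ℝ] ℝ) v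
  have e : ∀ i : Fin n, (fun j => if i = j then (1 : ℝ) else 0) = Pi.single i 1 := by
    intro i
    ext j
    simp [Pi.single_apply, eq_comm]
  simpa [e, mul_comm] using h

/-- if `W`, `F` are smooth, satisfy the classical master homotopy equation
`∂W/∂t + ⟨∇ₓW, F⟩ = 0`, and `x₀` is a differentiable curve of critical points of `W(t,·)`
with invertible Hessian, then `x₀'(t) = F(t, x₀ t)`. -/
theorem critical_point_moves_along_F (n : ℕ)
    (W : ℝ × (Fin n → ℝ) → ℝ) (F : ℝ × (Fin n → ℝ) → (Fin n → ℝ))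
    (hW : ContDiff ℝ (⊤ : ℕ∞) W) (hF : ContDiff ℝ (⊤ : ℕ∞) F)
    (hmaster : ∀ (t : ℝ) (x : Fin n → ℝ),
      deriv (fun s => W (s, x)) t + ∑ i, gradx n W t x i * F (t, x) i = 0)
    (x₀ : ℝ → Fin n → ℝ) (hx₀ : Differentiable ℝ x₀)
    (hcrit : ∀ t, gradx n W t (x₀ t) = 0)
    (hhess : ∀ t, IsUnit (hessx n W t (x₀ t)).det) :
    ∀ t, deriv x₀ t = F (t, x₀ t) := by
  have hW1 : Differentiable ℝ W := hW.differentiable (by simp)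
  have two_le : (2 : WithTop ℕ∞) ≤ ((⊤ : ℕ∞) : WithTop ℕ∞) :=
    WithTop.coe_le_coe.mpr (le_top : (2 : ℕ∞) ≤ ⊤)
  have hW' : Differentiable ℝ (fderiv ℝ W) :=
    ((hW.of_le two_le).fderiv_right (m := 1) (by norm_num)).differentiable (by simp)
  have hF1 : Differentiable ℝ F := hF.differentiable (by simp)
  have hmaster' : ∀ p : ℝ × (Fin n → ℝ), fderiv ℝ W p (1, F p) = 0 := by
    rintro ⟨t, x⟩
    have h := hmaster t x
    simp only [deriv_time_eq_fderiv hW1, gradx_eq_fderiv hW1] at h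
    rw [← map_zero_prodMk_eq_sum, ← map_add] at h
    simpa using h
  have hcrit' : ∀ t v, fderiv ℝ W (t, x₀ t) (0, v) = 0 := by
    intro t v
    rw [map_zero_prodMk_eq_sum]
    simp [← gradx_eq_fderiv hW1, hcrit t]
  intro t
  have hsymm : IsSymmSndFDerivAt ℝ W (t, x₀ t) :=
    hW.contDiffAt.isSymmSndFDerivAt (by simpa using two_le)
  have hspace : ∀ v, fderiv ℝ (fderiv ℝ W) (t, x₀ t) (0, v) (1, F (t, x₀ t)) = 0 := by
    intro v
    have h := (hW' (t, x₀ t)).hasFDerivAt.clm_apply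
      ((hasFDerivAt_const (1 : ℝ) (t, x₀ t)).prodMk (hF1 (t, x₀ t)).hasFDerivAt)
    have h0 := h.unique ((hasFDerivAt_const (0 : ℝ) (t, x₀ t)).congr_of_eventuallyEq
      (Filter.Eventually.of_forall hmaster'))
    simpa [hcrit'] using DFunLike.congr_fun h0 ((0 : ℝ), v)
  have hcurve : ∀ v, fderiv ℝ (fderiv ℝ W) (t, x₀ t) (1, deriv x₀ t) (0, v) = 0 := by
    intro v
    have hpath : HasDerivAt (fun s => (s, x₀ s)) (1, deriv x₀ t) t :=
      (hasDerivAt_id t).prodMk (hx₀ t).hasDerivAt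
    have hgrad : HasDerivAt (fun s => fderiv ℝ W (s, x₀ s))
        (fderiv ℝ (fderiv ℝ W) (t, x₀ t) (1, deriv x₀ t)) t :=
      HasFDerivAt.comp_hasDerivAt (f := fun s => (s, x₀ s)) t
        (hW' (t, x₀ t)).hasFDerivAt hpath
    have h := hgrad.clm_apply (hasDerivAt_const t ((0 : ℝ), v))
    have h0 := h.unique ((hasDerivAt_const t (0 : ℝ)).congr_of_eventuallyEq
      (Filter.Eventually.of_forall fun s => hcrit' s v))
    simpa using h0
  have hker : hessx n W t (x₀ t) *ᵥ (deriv x₀ t - F (t, x₀ t)) = 0 := by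
    ext i
    simp only [Matrix.mulVec, dotProduct, hessx_eq_fderiv_fderiv hW1 hW', Pi.zero_apply]
    rw [← map_zero_prodMk_eq_sum]
    have h1 := hcurve (Pi.single i 1)
    rw [hsymm.eq] at h1
    have h2 := hspace (Pi.single i 1)
    have h3 := sub_eq_zero.mpr (h1.trans h2.symm)
    rw [← map_sub] at h3
    simpa using h3
  exact sub_eq_zero.mp (Matrix.eq_zero_of_mulVec_eq_zero (hhess t).ne_zero hker)
end

section
/- Let W : ℝ × ℝⁿ → ℝ and F : ℝ × ℝⁿ → ℝⁿ be smooth (C^∞) functions satisfying the classical master homotopy equation ∂W/∂t(t,x) + ⟨∇_x W(t,x), F(t,x)⟩ = 0 for all (t,x). Let x₀ : ℝ → ℝⁿ be a differentiable curve of critical points, i.e. ∇_x W(t, x₀(t)) = 0 for all t, with invertible Hessian A(t) = (∂_i∂_j W)(t, x₀(t)) for every t, and let Δ(t) = A(t)⁻¹ be the propagator. Let J(t) = (D_x F)(t, x₀(t)) be the n×n Jacobian matrix of F in the x-variables evaluated along the critical curve. Then the propagator satisfies the differential equation Δ'(t) = J(t)·Δ(t) + Δ(t)·J(t)ᵀ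 for all t. -/
open scoped BigOperators
open Matrix

section DirectionalDerivatives

variable {E : Type*} [NormedAddCommGroup E] [NormedSpace ℝ E]

lemma ContDiff.fderiv_apply_const {f : E → ℝ} (hf : ContDiff ℝ (⊤ : ℕ∞) f) (v : E) :
    ContDiff ℝ (⊤ : ℕ∞) fun p => fderiv ℝ f p v :=
  (hf.fderiv_right (m := ((⊤ : ℕ∞) : WithTop ℕ∞)) le_rfl).clm_apply contDiff_const

lemma ContDiff.differentiable_of_top {f : E → ℝ} (hf : ContDiff ℝ (⊤ : ℕ∞) f) :
    Differentiable ℝ f :=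
  hf.differentiable (by simp)

/-- Directional derivatives of a smooth function commute. -/
lemma fderiv_fderiv_apply_comm {f : E → ℝ} (hf : ContDiff ℝ (⊤ : ℕ∞) f) (v w p : E) :
    fderiv ℝ (fun q => fderiv ℝ f q v) p w = fderiv ℝ (fun q => fderiv ℝ f q w) p v := by
  have hd : DifferentiableAt ℝ (fderiv ℝ f) p :=
    (hf.fderiv_right (m := ((⊤ : ℕ∞) : WithTop ℕ∞)) le_rfl).differentiable (by simp) p
  have hs : IsSymmSndFDerivAt ℝ f p :=
    hf.contDiffAt.isSymmSndFDerivAt (by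
      rw [minSmoothness_of_isRCLikeNormedField]
      exact WithTop.coe_le_coe.2 (le_top : (2 : ℕ∞) ≤ ⊤))
  rw [fderiv_clm_apply hd (differentiableAt_const v),
    fderiv_clm_apply hd (differentiableAt_const w)]
  simpa using hs w v

lemma fderiv_sum_mul_apply {ι : Type*} [Fintype ι] {f g : ι → E → ℝ}
    (hf : ∀ i, Differentiable ℝ (f i)) (hg : ∀ i, Differentiable ℝ (g i)) (p v : E) :
    fderiv ℝ (fun q => ∑ i, f i q * g i q) p v =
      ∑ i, (fderiv ℝ (f i) p v * g i p + f i p * fderiv ℝ (g i) p v) := by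
  rw [fderiv_fun_sum fun i _ => (hf i p).fun_mul (hg i p), _root_.sum_apply]
  refine Finset.sum_congr rfl fun i _ => ?_
  rw [fderiv_fun_mul (hf i p) (hg i p)]
  simp only [_root_.add_apply, _root_.smul_apply, smul_eq_mul]
  ring

end DirectionalDerivatives

lemma fderiv_comp_prodMk_left_apply {E : Type*} [NormedAddCommGroup E] [NormedSpace ℝ E]
    {f : ℝ × E → ℝ} (hf : Differentiable ℝ f) (t : ℝ) (x v : E) :
    fderiv ℝ (fun y => f (t, y)) x v = fderiv ℝ f (t, x) (0, v) := by
  have h := (hf (t, x)).hasFDerivAt.comp x (hasFDerivAt_prodMk_right t x)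
  rw [show (fun y => f (t, y)) = f ∘ fun y => (t, y) from rfl, h.fderiv]
  simp

lemma deriv_comp_prodMk_right {E : Type*} [NormedAddCommGroup E] [NormedSpace ℝ E]
    {f : ℝ × E → ℝ} (hf : Differentiable ℝ f) (t : ℝ) (x : E) :
    deriv (fun s => f (s, x)) t = fderiv ℝ f (t, x) (1, 0) := by
  have h := (hf (t, x)).hasFDerivAt.comp_hasDerivAt t
    ((hasDerivAt_id t).prodMk (hasDerivAt_const t x))
  exact h.deriv

/-- The chain rule for a function of `(t, x)` along a curve, in coordinates. -/
lemma hasDerivAt_comp_graph {n : ℕ} {f : ℝ × (Fin n → ℝ) → ℝ} (hf : Differentiable ℝ f)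
    {c : ℝ → Fin n → ℝ} {c' : Fin n → ℝ} {t : ℝ} (hc : HasDerivAt c c' t) :
    HasDerivAt (fun s => f (s, c s))
      (fderiv ℝ f (t, c t) (1, 0)
        + ∑ i, c' i * fderiv ℝ f (t, c t) (0, Pi.single i 1)) t := by
  have h := (hf (t, c t)).hasFDerivAt.comp_hasDerivAt t ((hasDerivAt_id t).prodMk hc)
  convert! h using 1
  have hv : ((1 : ℝ), c') = (1, 0) + ∑ i, c' i • ((0 : ℝ), (Pi.single i 1 : Fin n → ℝ)) := by
    refine Prod.ext ?_ ?_
    · simp [Prod.fst_sum]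
    · ext k
      simp [Prod.snd_sum, Finset.sum_apply, Pi.single_apply]
  rw [hv, map_add, map_sum]
  simp only [map_smul, smul_eq_mul]

section MatrixInverse

attribute [local instance] Matrix.linftyOpNormedRing Matrix.linftyOpNormedAlgebra

lemma hasDerivAt_matrix_inv {ι : Type*} [Fintype ι] [DecidableEq ι] {A : ℝ → Matrix ι ι ℝ}
    {A' : Matrix ι ι ℝ} {t : ℝ} (hA : ∀ i j, HasDerivAt (fun s => A s i j) (A' i j) t)
    (hu : IsUnit (A t).det) (i j : ι) :
    HasDerivAt (fun s => (A s)⁻¹ i j) ((-((A t)⁻¹ * A' * (A t)⁻¹)) i j) t := by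
  have hm : HasDerivAt A A' t := hasDerivAt_pi.2 fun i => hasDerivAt_pi.2 fun j => hA i j
  obtain ⟨u, hu'⟩ := (Matrix.isUnit_iff_isUnit_det _).2 hu
  have hr := hasFDerivAt_ringInverse (𝕜 := ℝ) u
  have hinv : (A t)⁻¹ = ↑u⁻¹ := by rw [← hu', Matrix.coe_units_inv]
  rw [hu'] at hr
  have h := hr.comp_hasDerivAt t hm
  have h2 := hasDerivAt_pi.1 (hasDerivAt_pi.1 h i) j
  simp only [Function.comp_apply, ← Matrix.nonsing_inv_eq_ringInverse] at h2
  rw [hinv]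
  exact h2

end MatrixInverse

section CriticalCurve

variable {n : ℕ} {W : ℝ × (Fin n → ℝ) → ℝ} {F : ℝ × (Fin n → ℝ) → (Fin n → ℝ)}

lemma gradx_apply_eq (hW : ContDiff ℝ (⊤ : ℕ∞) W) (t : ℝ) (x : Fin n → ℝ) (i : Fin n) :
    gradx n W t x i = fderiv ℝ W (t, x) (0, Pi.single i 1) :=
  fderiv_comp_prodMk_left_apply hW.differentiable_of_top t x _

lemma hessx_apply_eq (hW : ContDiff ℝ (⊤ : ℕ∞) W) (t : ℝ) (x : Fin n → ℝ) (i j : Fin n) :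
    hessx n W t x i j =
      fderiv ℝ (fun p => fderiv ℝ W p (0, Pi.single j 1)) (t, x) (0, Pi.single i 1) := by
  simp only [hessx, Matrix.of_apply, gradx_apply_eq hW]
  exact fderiv_comp_prodMk_left_apply
    (hW.fderiv_apply_const (0, Pi.single j 1)).differentiable_of_top t x _

lemma jacx_apply_eq (hF : ContDiff ℝ (⊤ : ℕ∞) F) (t : ℝ) (x : Fin n → ℝ) (i j : Fin n) :
    jacx n F t x i j = fderiv ℝ (fun p => F p i) (t, x) (0, Pi.single j 1) :=
  fderiv_comp_prodMk_left_apply (contDiff_pi.1 hF i).differentiable_of_top t x _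

lemma hessx_isSymm (hW : ContDiff ℝ (⊤ : ℕ∞) W) (t : ℝ) (x : Fin n → ℝ) :
    (hessx n W t x).IsSymm := by
  ext i j
  rw [Matrix.transpose_apply, hessx_apply_eq hW, hessx_apply_eq hW]
  exact fderiv_fderiv_apply_comm hW _ _ _

/-- First `x`-derivative of the master homotopy equation. -/
lemma master_fderiv (hW : ContDiff ℝ (⊤ : ℕ∞) W) (hF : ContDiff ℝ (⊤ : ℕ∞) F)
    (hmaster : ∀ (t : ℝ) (x : Fin n → ℝ),
      deriv (fun s => W (s, x)) t + ∑ i, gradx n W t x i * F (t, x) i = 0)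
    (p : ℝ × (Fin n → ℝ)) (k : Fin n) :
    fderiv ℝ (fun q => fderiv ℝ W q (0, Pi.single k 1)) p (1, 0)
      + ∑ i, (fderiv ℝ (fun q => fderiv ℝ W q (0, Pi.single k 1)) p (0, Pi.single i 1) * F p i
        + fderiv ℝ W p (0, Pi.single i 1)
          * fderiv ℝ (fun q => F q i) p (0, Pi.single k 1)) = 0 := by
  have hFd : ∀ i, Differentiable ℝ fun q => F q i :=
    fun i => (contDiff_pi.1 hF i).differentiable_of_top
  have hWd : ∀ v, Differentiable ℝ fun q => fderiv ℝ W q v :=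
    fun v => (hW.fderiv_apply_const v).differentiable_of_top
  have h0 : (fun q => fderiv ℝ W q (1, 0)
      + ∑ i, fderiv ℝ W q (0, Pi.single i 1) * F q i) = fun _ => 0 := by
    funext ⟨t, x⟩
    have h := hmaster t x
    simp only [deriv_comp_prodMk_right hW.differentiable_of_top, gradx_apply_eq hW] at h
    exact h
  have h1 := congrArg (fun f => fderiv ℝ f p (0, Pi.single k 1)) h0
  simp only [fderiv_fun_const, Pi.zero_apply, _root_.zero_apply] at h1
  rw [fderiv_fun_add (hWd _ p)
    (DifferentiableAt.fun_sum fun i _ => (hWd _ p).fun_mul (hFd i p)),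
    _root_.add_apply, fderiv_sum_mul_apply (fun i => hWd _) hFd,
    fderiv_fderiv_apply_comm hW] at h1
  simpa only [fderiv_fderiv_apply_comm hW _ (0, Pi.single k 1)] using h1

/-- Second `x`-derivative of the master homotopy equation at a critical point. -/
lemma master_fderiv_fderiv (hW : ContDiff ℝ (⊤ : ℕ∞) W) (hF : ContDiff ℝ (⊤ : ℕ∞) F)
    (hmaster : ∀ (t : ℝ) (x : Fin n → ℝ),
      deriv (fun s => W (s, x)) t + ∑ i, gradx n W t x i * F (t, x) i = 0)
    {t : ℝ} {x : Fin n → ℝ} (hx : gradx n W t x = 0) (l k : Fin n) :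
    fderiv ℝ (fun p => fderiv ℝ (fun q => fderiv ℝ W q (0, Pi.single k 1)) p
        (0, Pi.single l 1)) (t, x) (1, 0)
      + ∑ i, F (t, x) i * fderiv ℝ (fun p => fderiv ℝ (fun q => fderiv ℝ W q
          (0, Pi.single k 1)) p (0, Pi.single l 1)) (t, x) (0, Pi.single i 1) =
      -(hessx n W t x * jacx n F t x + (jacx n F t x)ᵀ * hessx n W t x) l k := by
  have hFd : ∀ i, Differentiable ℝ fun q => F q i :=
    fun i => (contDiff_pi.1 hF i).differentiable_of_top
  have hFd' : ∀ i v, Differentiable ℝ fun q => fderiv ℝ (fun q => F q i) q v :=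
    fun i v => ((contDiff_pi.1 hF i).fderiv_apply_const v).differentiable_of_top
  have hWs : ∀ v, ContDiff ℝ (⊤ : ℕ∞) fun q => fderiv ℝ W q v := hW.fderiv_apply_const
  have hWd : ∀ v, Differentiable ℝ fun q => fderiv ℝ W q v :=
    fun v => (hWs v).differentiable_of_top
  have hWd' : ∀ v w, Differentiable ℝ fun p => fderiv ℝ (fun q => fderiv ℝ W q v) p w :=
    fun v w => ((hWs v).fderiv_apply_const w).differentiable_of_top
  have hgrad : ∀ i, fderiv ℝ W (t, x) (0, Pi.single i 1) = 0 := fun i => by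
    rw [← gradx_apply_eq hW, hx, Pi.zero_apply]
  have h1 := congrArg (fun f => fderiv ℝ f (t, x) (0, Pi.single l 1))
    (funext fun p => master_fderiv hW hF hmaster p k)
  simp only [fderiv_fun_const, Pi.zero_apply, _root_.zero_apply,
    Finset.sum_add_distrib] at h1
  have hs1 : Differentiable ℝ fun p => ∑ i, fderiv ℝ (fun q => fderiv ℝ W q
      (0, Pi.single k 1)) p (0, Pi.single i 1) * F p i :=
    fun p => DifferentiableAt.fun_sum fun i _ => (hWd' _ _ p).fun_mul (hFd i p)
  have hs2 : Differentiable ℝ fun p => ∑ i, fderiv ℝ W p (0, Pi.single i 1)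
      * fderiv ℝ (fun q => F q i) p (0, Pi.single k 1) :=
    fun p => DifferentiableAt.fun_sum fun i _ => (hWd _ p).fun_mul (hFd' i _ p)
  rw [fderiv_fun_add (hWd' _ _ _) ((hs1 _).fun_add (hs2 _)), _root_.add_apply,
    fderiv_fun_add (hs1 _) (hs2 _), _root_.add_apply,
    fderiv_sum_mul_apply (fun i => hWd' _ _) hFd,
    fderiv_sum_mul_apply (fun i => hWd _) (fun i => hFd' i _),
    fderiv_fderiv_apply_comm (hWs _)] at h1
  simp only [fderiv_fderiv_apply_comm (hWs _) _ (0, Pi.single l 1)] at h1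
  simp only [← hessx_apply_eq hW, ← jacx_apply_eq hF, hgrad, zero_mul, add_zero,
    Finset.sum_add_distrib] at h1 ⊢
  simp only [Matrix.add_apply, Matrix.mul_apply, Matrix.transpose_apply]
  have e1 : ∑ i, hessx n W t x i k * jacx n F t x i l
      = ∑ i, jacx n F t x i l * hessx n W t x i k :=
    Finset.sum_congr rfl fun i _ => mul_comm _ _
  have e2 : ∀ G : Fin n → ℝ, ∑ i, F (t, x) i * G i = ∑ i, G i * F (t, x) i :=
    fun G => Finset.sum_congr rfl fun i _ => mul_comm _ _
  rw [e2]
  linarith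

/-- A curve of nondegenerate critical points is an integral curve of `F`. -/
lemma hasDerivAt_critical_curve (hW : ContDiff ℝ (⊤ : ℕ∞) W) (hF : ContDiff ℝ (⊤ : ℕ∞) F)
    (hmaster : ∀ (t : ℝ) (x : Fin n → ℝ),
      deriv (fun s => W (s, x)) t + ∑ i, gradx n W t x i * F (t, x) i = 0)
    {x₀ : ℝ → Fin n → ℝ} (hcrit : ∀ t, gradx n W t (x₀ t) = 0) {t : ℝ}
    (hx₀ : DifferentiableAt ℝ x₀ t) (hhess : IsUnit (hessx n W t (x₀ t)).det) :
    HasDerivAt x₀ (F (t, x₀ t)) t := by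
  suffices h : deriv x₀ t = F (t, x₀ t) from h ▸ hx₀.hasDerivAt
  rw [← sub_eq_zero]
  refine Matrix.eq_zero_of_mulVec_eq_zero hhess.ne_zero ?_
  ext k
  have h1 := hasDerivAt_comp_graph
    (hW.fderiv_apply_const (0, Pi.single k 1)).differentiable_of_top hx₀.hasDerivAt
  have hgrad : ∀ s i, fderiv ℝ W (s, x₀ s) (0, Pi.single i 1) = 0 := fun s i => by
    rw [← gradx_apply_eq hW, hcrit, Pi.zero_apply]
  have h0 : (fun s => fderiv ℝ W (s, x₀ s) (0, Pi.single k 1)) = fun _ => 0 :=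
    funext fun s => hgrad s k
  rw [h0] at h1
  have h2 := h1.unique (hasDerivAt_const t (0 : ℝ))
  have h3 := master_fderiv hW hF hmaster (t, x₀ t) k
  simp only [← hessx_apply_eq hW, hgrad, zero_mul, add_zero] at h2 h3
  simp only [Matrix.mulVec, dotProduct, Pi.sub_apply, Pi.zero_apply, mul_sub,
    Finset.sum_sub_distrib]
  have e : ∀ v : Fin n → ℝ, ∑ i, hessx n W t (x₀ t) k i * v i
      = ∑ i, v i * hessx n W t (x₀ t) i k := fun v =>
    Finset.sum_congr rfl fun i _ => by rw [mul_comm, (hessx_isSymm hW t (x₀ t)).apply]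
  rw [e, e]
  have e3 : ∑ i, F (t, x₀ t) i * hessx n W t (x₀ t) i k
      = ∑ i, hessx n W t (x₀ t) i k * F (t, x₀ t) i :=
    Finset.sum_congr rfl fun i _ => mul_comm _ _
  linarith

end CriticalCurve

/-- under the classical master homotopy equation, the propagator
`Δ(t) = A(t)⁻¹` (inverse Hessian along the critical curve) satisfies
`Δ'(t) = J(t)·Δ(t) + Δ(t)·J(t)ᵀ`, where `J(t) = (DₓF)(t, x₀ t)`. -/
theorem propagator_derivative_along_critical_curve (n : ℕ)
    (W : ℝ × (Fin n → ℝ) → ℝ) (F : ℝ × (Fin n → ℝ) → (Fin n → ℝ))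
    (hW : ContDiff ℝ (⊤ : ℕ∞) W) (hF : ContDiff ℝ (⊤ : ℕ∞) F)
    (hmaster : ∀ (t : ℝ) (x : Fin n → ℝ),
      deriv (fun s => W (s, x)) t + ∑ i, gradx n W t x i * F (t, x) i = 0)
    (x₀ : ℝ → Fin n → ℝ) (hx₀ : Differentiable ℝ x₀)
    (hcrit : ∀ t, gradx n W t (x₀ t) = 0)
    (hhess : ∀ t, IsUnit (hessx n W t (x₀ t)).det) :
    ∀ (t : ℝ) (i j : Fin n),
      deriv (fun s => (hessx n W s (x₀ s))⁻¹ i j) t =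
        (jacx n F t (x₀ t) * (hessx n W t (x₀ t))⁻¹
          + (hessx n W t (x₀ t))⁻¹ * (jacx n F t (x₀ t))ᵀ) i j := by
  intro t i j
  have hA : ∀ l k, HasDerivAt (fun s => hessx n W s (x₀ s) l k)
      ((-(hessx n W t (x₀ t) * jacx n F t (x₀ t)
        + (jacx n F t (x₀ t))ᵀ * hessx n W t (x₀ t))) l k) t := by
    intro l k
    have h := hasDerivAt_comp_graph
      ((hW.fderiv_apply_const (0, Pi.single k 1)).fderiv_apply_const
        (0, Pi.single l 1)).differentiable_of_top
      (hasDerivAt_critical_curve hW hF hmaster hcrit (hx₀ t) (hhess t))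
    rw [master_fderiv_fderiv hW hF hmaster (hcrit t)] at h
    simp only [← hessx_apply_eq hW] at h
    exact h
  rw [(hasDerivAt_matrix_inv hA (hhess t) i j).deriv]
  rw [mul_neg, neg_mul, neg_neg, mul_add, add_mul, Matrix.nonsing_inv_mul_cancel_left _ _ (hhess t),
    ← mul_assoc, Matrix.mul_nonsing_inv_cancel_right _ _ (hhess t)]
end
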